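/- Let q be a prime power and let d, m be positive integers with d | q−1, m ≥ 2 and gcd(m,d) = 1. Then there exist sets K₀′,…,K_{d−1}′ and a ((q^m−1)/d, {K₀′,…,K_{d−1}′}, 1)-BNCDP of size d(q^{m−1}−1)/(q−1) + 1 over Z_{(q^m−1)/d} such that for each of the d CDPs, the set of all elements of its base blocks is a complete system of representatives for the cosets of ((q^m−1)/(q−1))·Z_{(q^m−1)/d} in Z_{(q^m−1)/d}. -/

import Mathlib

open scoped Classical

/-- The multiset of all elements of the base blocks of a family `B`. -/
def blockElems {n u : ℕ} (B : Fin u → Finset (ZMod n)) : Multiset (ZMod n) :=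
  ∑ i : Fin u, (B i).val

/-- The multiset of internal differences `Δ(B)`. -/
def deltaList {n u : ℕ} (B : Fin u → Finset (ZMod n)) : Multiset (ZMod n) :=
  ∑ i : Fin u, (((B i) ×ˢ (B i)).filter (fun p => p.1 ≠ p.2)).val.map (fun p => p.1 - p.2)

/-- The multiset of external differences `Δ_E(B, B')`. -/
def deltaE {n u : ℕ} (B B' : Fin u → Finset (ZMod n)) : Multiset (ZMod n) :=
  ∑ i : Fin u, ((B i) ×ˢ (B' i)).val.map (fun p => p.2 - p.1)

/-- `x` is a multiple of `d` in `ZMod n`, i.e. `x ∈ d·Z_n`. -/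
def inSub (n d : ℕ) (x : ZMod n) : Prop := ∃ y : ZMod n, x = (d : ZMod n) * y

/-- The multiset `T` is a complete system of representatives for the cosets of
`d·Z_n` in `Z_n`: each coset contains exactly one element of `T`
(counted with multiplicity). -/
def IsCSR (n d : ℕ) (T : Multiset (ZMod n)) : Prop :=
  ∀ x : ZMod n, Multiset.card (T.filter (fun t => inSub n d (x - t))) = 1

/-- `B` is an `(n, K, λ)`-CDP. -/
def IsCDP (n u lam : ℕ) (K : Set ℕ) (B : Fin u → Finset (ZMod n)) : Prop :=
  (∀ i, (B i).card ∈ K) ∧ ∀ x : ZMod n, x ≠ 0 → (deltaList B).count x ≤ lam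

/-- `B` is an `(n, {K₀,…,K_{M−1}}, λ)`-BNCDP of size `u`. -/
def IsBNCDP (n M u lam : ℕ) (K : Fin M → Set ℕ)
    (B : Fin M → Fin u → Finset (ZMod n)) : Prop :=
  (∀ j, IsCDP n u lam (K j) (B j)) ∧
  ∀ j j' : Fin M, j ≠ j' → ∀ x : ZMod n, (deltaE (B j) (B j')).count x ≤ lam

/-- `B` is an `(n, g, K, 1)`-CRDP (relative to the subgroup `H = (n/g)·Z_n` of order `g`). -/
def IsCRDP (n g u : ℕ) (K : Set ℕ) (B : Fin u → Finset (ZMod n)) : Prop :=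
  (∀ i, (B i).card ∈ K) ∧
  (∀ x : ZMod n, inSub n (n / g) x → (deltaList B).count x = 0) ∧
  (∀ x : ZMod n, (deltaList B).count x ≤ 1)

/-- `B` is an `(n, g, {K₀,…,K_{M−1}}, 1)`-BNCRDP of size `u`. -/
def IsBNCRDP (n g M u : ℕ) (K : Fin M → Set ℕ)
    (B : Fin M → Fin u → Finset (ZMod n)) : Prop :=
  (∀ j, IsCRDP n g u (K j) (B j)) ∧
  ∀ j j' : Fin M, j ≠ j' →
    (∀ x : ZMod n, inSub n (n / g) x → (deltaE (B j) (B j')).count x = 0) ∧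
    (∀ x : ZMod n, (deltaE (B j) (B j')).count x ≤ 1)

theorem count_sum_map_le_one {ι α β : Type*} [Fintype ι] [DecidableEq β]
    (S : ι → Finset α) (g : α → β) (x : β)
    (h : ∀ i i', ∀ y ∈ S i, ∀ y' ∈ S i', g y = x → g y' = x → i = i' ∧ y = y') :
    (∑ i, (S i).val.map g).count x ≤ 1 := by
  have key : (∑ i, (S i).val.map g).count x
      = (Finset.univ.sigma fun i => (S i).filter fun y => x = g y).card := by
    rw [Multiset.count_sum', Finset.card_sigma]
    exact Finset.sum_congr rfl fun i _ => by rw [Multiset.count_map]; rfl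
  rw [key, Finset.card_le_one]
  rintro ⟨i, y⟩ hy ⟨i', y'⟩ hy'
  simp only [Finset.mem_sigma, Finset.mem_univ, true_and, Finset.mem_filter] at hy hy'
  obtain ⟨rfl, rfl⟩ := h i i' y hy.1 y' hy'.1 hy.2.symm hy'.2.symm
  rfl

theorem card_filter_sum_eq_one {ι α : Type*} [Fintype ι] (S : ι → Finset α) (p : α → Prop)
    (hex : ∃ i, ∃ y ∈ S i, p y)
    (huniq : ∀ i i', ∀ y ∈ S i, ∀ y' ∈ S i', p y → p y' → i = i' ∧ y = y') :
    Multiset.card ((∑ i, (S i).val).filter p) = 1 := by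
  have key : Multiset.card ((∑ i, (S i).val).filter p)
      = (Finset.univ.sigma fun i => (S i).filter p).card := by
    rw [Finset.card_sigma, ← Multiset.countP_eq_card_filter,
      ← Multiset.coe_countPAddMonoidHom, map_sum]
    exact Finset.sum_congr rfl fun i _ => by
      rw [Multiset.coe_countPAddMonoidHom, Multiset.countP_eq_card_filter]; rfl
  obtain ⟨i, y, hy, hp⟩ := hex
  rw [key, Finset.card_eq_one]
  refine ⟨⟨i, y⟩, Finset.eq_singleton_iff_unique_mem.2 ⟨by simp [hy, hp], ?_⟩⟩
  rintro ⟨i', y'⟩ hy'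
  simp only [Finset.mem_sigma, Finset.mem_univ, true_and, Finset.mem_filter] at hy'
  obtain ⟨rfl, rfl⟩ := huniq i' i y' hy'.1 y hy hy'.2 hp
  rfl

/-- A family `a` of representatives for the points of the projective space of `E / L`. -/
structure IsLineReps {E P : Type*} [Field E] (L : Subfield E) (a : P → E) : Prop where
  notMem : ∀ p, a p ∉ L
  exists_eq : ∀ y ∉ L, ∃ p, ∃ b ∈ L, ∃ t ∈ L, y = b * (a p + t)
  eq_of_eq : ∀ p p', ∀ b ∈ L, ∀ t ∈ L, a p' = b * a p + t → p = p'

section Blocks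

variable {E P : Type*} [Field E] {L : Subfield E} {a : P → E}

theorem IsLineReps.eq_of_mul_eq (ha : IsLineReps L a) {p p' : P} {t₁ t₂ t₁' t₂' : E}
    (h₁ : t₁ ∈ L) (h₂ : t₂ ∈ L) (h₁' : t₁' ∈ L) (h₂' : t₂' ∈ L) (hne : t₁ ≠ t₂)
    (h : (a p + t₁) * (a p' + t₂') = (a p' + t₁') * (a p + t₂)) :
    p = p' ∧ t₁ = t₁' ∧ t₂ = t₂' := by
  have hδ : t₁ - t₂ ≠ 0 := sub_ne_zero.2 hne
  have hp : p = p' := by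
    refine ha.eq_of_eq p p' ((t₁' - t₂') / (t₁ - t₂))
      (L.div_mem (L.sub_mem h₁' h₂') (L.sub_mem h₁ h₂))
      ((t₁' - t₂') / (t₁ - t₂) * t₂ - t₂')
      (L.sub_mem (L.mul_mem (L.div_mem (L.sub_mem h₁' h₂') (L.sub_mem h₁ h₂)) h₂) h₂') ?_
    field_simp
    linear_combination h
  subst hp
  have hδ' : t₁ - t₂ = t₁' - t₂' := by
    by_contra hne'
    have h0 : t₁ - t₂ - (t₁' - t₂') ≠ 0 := sub_ne_zero.2 hne'
    refine ha.notMem p ?_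
    have : a p = (t₁' * t₂ - t₁ * t₂') / (t₁ - t₂ - (t₁' - t₂')) := by
      field_simp
      linear_combination h
    rw [this]
    exact L.div_mem (L.sub_mem (L.mul_mem h₁' h₂) (L.mul_mem h₁ h₂'))
      (L.sub_mem (L.sub_mem h₁ h₂) (L.sub_mem h₁' h₂'))
  have h2 : t₂ = t₂' := by
    have : (t₁ - t₂) * (t₂' - t₂) = 0 := by
      linear_combination h - (a p + t₂) * hδ'
    rcases mul_eq_zero.1 this with h | h
    · exact absurd h hδ
    · exact (sub_eq_zero.1 h).symm
  exact ⟨rfl, by linear_combination hδ' + h2, h2⟩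

theorem IsLineReps.eq_of_eq_mul (ha : IsLineReps L a) {p p' : P} {t t' b : E}
    (ht : t ∈ L) (ht' : t' ∈ L) (hb : b ∈ L) (h : a p' + t' = b * (a p + t)) :
    p = p' ∧ t = t' := by
  have hp : p = p' := ha.eq_of_eq p p' b hb (b * t - t') (L.sub_mem (L.mul_mem hb ht) ht')
    (by linear_combination h)
  subst hp
  have hb1 : b = 1 := by
    by_contra hne
    have h0 : 1 - b ≠ 0 := sub_ne_zero.2 (Ne.symm hne)
    refine ha.notMem p ?_
    have : a p = (b * t - t') / (1 - b) := by
      field_simp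
      linear_combination h
    rw [this]
    exact L.div_mem (L.sub_mem (L.mul_mem hb ht) ht') (L.sub_mem L.one_mem hb)
  refine ⟨rfl, ?_⟩
  rw [hb1] at h
  linear_combination -h

theorem IsLineReps.add_ne_zero (ha : IsLineReps L a) {p : P} {t : E} (ht : t ∈ L) :
    a p + t ≠ 0 := fun h => ha.notMem p (by
  rw [eq_neg_of_add_eq_zero_left h]; exact L.neg_mem ht)

variable {n d : ℕ} [NeZero n] (ψ : Multiplicative (ZMod n) →* Eˣ) (c : rootsOfUnity d E → E)

/-- The blocks obtained by splitting the affine lines `a p + L` according to the value of the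
`n`-th power, and scaling the parts into the image of `ψ`. -/
noncomputable def splitBlock (L : Subfield E) (a : P → E) (j : rootsOfUnity d E) :
    Option (P × rootsOfUnity d E) → Finset (ZMod n)
  | none => {0}
  | some (p, k) => Finset.univ.filter fun z => ∃ t ∈ L,
      (ψ (Multiplicative.ofAdd z) : E) = c k * c j * (a p + t) ∧
      (a p + t) ^ n = ((k : Eˣ) : E) * ((j : Eˣ) : E)

variable {ψ c}

theorem splitBlock_eq_of_sub_eq (ha : IsLineReps L a) (hψ : Function.Injective ψ)
    (hcL : ∀ k, c k ∈ L) (hc0 : ∀ k, c k ≠ 0) {j j' : rootsOfUnity d E}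
    {i i' : Option (P × rootsOfUnity d E)} {z₁ z₂ w₁ w₂ : ZMod n}
    (hz₁ : z₁ ∈ splitBlock ψ c L a j i) (hz₂ : z₂ ∈ splitBlock ψ c L a j' i)
    (hw₁ : w₁ ∈ splitBlock ψ c L a j i') (hw₂ : w₂ ∈ splitBlock ψ c L a j' i')
    (hne : j = j' → z₁ ≠ z₂) (hne' : j = j' → w₁ ≠ w₂) (h : z₁ - z₂ = w₁ - w₂) :
    i = i' ∧ z₁ = w₁ ∧ z₂ = w₂ := by
  have hinj : ∀ z w : ZMod n, (ψ (Multiplicative.ofAdd z) : E) = ψ (Multiplicative.ofAdd w) →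
      z = w := fun z w e => Multiplicative.ofAdd.injective (hψ (Units.ext e))
  have hmul : (ψ (Multiplicative.ofAdd z₁) : E) * ψ (Multiplicative.ofAdd w₂)
      = ψ (Multiplicative.ofAdd w₁) * ψ (Multiplicative.ofAdd z₂) := by
    rw [← Units.val_mul, ← Units.val_mul, ← map_mul ψ, ← map_mul ψ, ← ofAdd_add, ← ofAdd_add,
      show z₁ + w₂ = w₁ + z₂ by linear_combination h]
  have hparam : ∀ {p : P} {k : rootsOfUnity d E} {t₁ t₂ : E} {x₁ x₂ : ZMod n},
      (j = j' → x₁ ≠ x₂) →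
      (ψ (Multiplicative.ofAdd x₁) : E) = c k * c j * (a p + t₁) →
      (ψ (Multiplicative.ofAdd x₂) : E) = c k * c j' * (a p + t₂) →
      (a p + t₁) ^ n = ((k : Eˣ) : E) * ((j : Eˣ) : E) →
      (a p + t₂) ^ n = ((k : Eˣ) : E) * ((j' : Eˣ) : E) → t₁ ≠ t₂ := by
    rintro p k t₁ t₂ x₁ x₂ hx e₁ e₂ f₁ f₂ rfl
    have hj : j = j' := by
      rw [f₁] at f₂
      exact Subtype.ext (Units.ext (mul_left_cancel₀ (Units.ne_zero _) f₂))
    subst hj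
    exact hx rfl (hinj _ _ (e₁.trans e₂.symm))
  have hconst : ∀ {p : P} {k : rootsOfUnity d E} {t₁ t₂ : E} {x₁ x₂ : ZMod n},
      (j = j' → x₁ ≠ x₂) → t₁ ∈ L → t₂ ∈ L →
      (ψ (Multiplicative.ofAdd x₁) : E) = c k * c j * (a p + t₁) →
      (ψ (Multiplicative.ofAdd x₂) : E) = c k * c j' * (a p + t₂) →
      (a p + t₁) ^ n = ((k : Eˣ) : E) * ((j : Eˣ) : E) →
      (a p + t₂) ^ n = ((k : Eˣ) : E) * ((j' : Eˣ) : E) → x₁ ≠ x₂ := by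
    rintro p k t₁ t₂ x₁ x₂ hx m₁ m₂ e₁ e₂ f₁ f₂ rfl
    have hq : a p + t₁ = c j' / c j * (a p + t₂) := by
      have h1 := e₁.symm.trans e₂
      rw [mul_assoc, mul_assoc] at h1
      have h2 := mul_left_cancel₀ (hc0 k) h1
      have := hc0 j
      field_simp
      linear_combination h2
    exact hparam hx e₁ e₂ f₁ f₂
      (ha.eq_of_eq_mul m₂ m₁ (L.div_mem (hcL _) (hcL _)) hq).2.symm
  rcases i with _ | ⟨p, k⟩ <;> rcases i' with _ | ⟨p', k'⟩ <;>
    simp only [splitBlock, Finset.mem_singleton, Finset.mem_filter, Finset.mem_univ,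
      true_and] at hz₁ hz₂ hw₁ hw₂
  · exact ⟨rfl, hz₁.trans hw₁.symm, hz₂.trans hw₂.symm⟩
  · obtain ⟨s₁, m₁, e₁, f₁⟩ := hw₁
    obtain ⟨s₂, m₂, e₂, f₂⟩ := hw₂
    rw [hz₁, hz₂, sub_self] at h
    exact absurd (sub_eq_zero.1 h.symm) (hconst hne' m₁ m₂ e₁ e₂ f₁ f₂)
  · obtain ⟨t₁, m₁, e₁, f₁⟩ := hz₁
    obtain ⟨t₂, m₂, e₂, f₂⟩ := hz₂
    rw [hw₁, hw₂, sub_self] at h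
    exact absurd (sub_eq_zero.1 h) (hconst hne m₁ m₂ e₁ e₂ f₁ f₂)
  · obtain ⟨t₁, m₁, e₁, f₁⟩ := hz₁
    obtain ⟨t₂, m₂, e₂, f₂⟩ := hz₂
    obtain ⟨s₁, m₁', e₁', f₁'⟩ := hw₁
    obtain ⟨s₂, m₂', e₂', f₂'⟩ := hw₂
    have hc : c k * c k' * c j * c j' ≠ 0 := by simp [hc0]
    have hcross : (a p + t₁) * (a p' + s₂) = (a p' + s₁) * (a p + t₂) := by
      rw [e₁, e₂, e₁', e₂'] at hmul
      exact mul_left_cancel₀ hc (by linear_combination hmul)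
    obtain ⟨rfl, rfl, rfl⟩ := ha.eq_of_mul_eq m₁ m₂ m₁' m₂'
      (hparam hne e₁ e₂ f₁ f₂) hcross
    have hk : k = k' := by
      rw [f₁] at f₁'
      exact Subtype.ext (Units.ext (mul_right_cancel₀ (Units.ne_zero _) f₁'))
    subst hk
    exact ⟨rfl, hinj _ _ (e₁.trans e₁'.symm), hinj _ _ (e₂.trans e₂'.symm)⟩

theorem splitBlock_eq_of_div_mem (ha : IsLineReps L a) (hψ : Function.Injective ψ)
    (hcL : ∀ k, c k ∈ L) (hc0 : ∀ k, c k ≠ 0) {j : rootsOfUnity d E}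
    {i i' : Option (P × rootsOfUnity d E)} {z w : ZMod n}
    (hz : z ∈ splitBlock ψ c L a j i) (hw : w ∈ splitBlock ψ c L a j i')
    (h : (ψ (Multiplicative.ofAdd (z - w)) : E) ∈ L) : i = i' ∧ z = w := by
  have hinj : ∀ z w : ZMod n, (ψ (Multiplicative.ofAdd z) : E) = ψ (Multiplicative.ofAdd w) →
      z = w := fun z w e => Multiplicative.ofAdd.injective (hψ (Units.ext e))
  have hmul : (ψ (Multiplicative.ofAdd z) : E)
      = ψ (Multiplicative.ofAdd (z - w)) * ψ (Multiplicative.ofAdd w) := by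
    rw [← Units.val_mul, ← map_mul ψ, ← ofAdd_add, sub_add_cancel]
  have hnot : ∀ {p : P} {k : rootsOfUnity d E} {t : E}, t ∈ L →
      c k * c j * (a p + t) ∉ L := by
    intro p k t ht hmem
    refine ha.notMem p ?_
    have : a p = c k * c j * (a p + t) / (c k * c j) - t := by
      have := hc0 k
      have := hc0 j
      field_simp
      ring
    rw [this]
    exact L.sub_mem (L.div_mem hmem (L.mul_mem (hcL _) (hcL _))) ht
  rcases i with _ | ⟨p, k⟩ <;> rcases i' with _ | ⟨p', k'⟩ <;>
    simp only [splitBlock, Finset.mem_singleton, Finset.mem_filter, Finset.mem_univ,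
      true_and] at hz hw
  · exact ⟨rfl, hz.trans hw.symm⟩
  · obtain ⟨t, m, e, f⟩ := hw
    refine absurd ?_ (hnot (p := p') (k := k') m)
    rw [← e, show w = -(z - w) by rw [hz]; ring, ofAdd_neg, map_inv, Units.val_inv_eq_inv_val]
    exact L.inv_mem h
  · obtain ⟨t, m, e, f⟩ := hz
    refine absurd ?_ (hnot (p := p) (k := k) m)
    rw [← e]
    simpa [hw] using h
  · obtain ⟨t, m, e, f⟩ := hz
    obtain ⟨t', m', e', f'⟩ := hw
    rw [e, e'] at hmul
    obtain ⟨rfl, rfl⟩ := ha.eq_of_eq_mul (p := p') (p' := p) m' m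
      (b := ψ (Multiplicative.ofAdd (z - w)) * c k' / c k)
      (L.div_mem (L.mul_mem h (hcL _)) (hcL _)) (by
        have := hc0 k
        have := hc0 j
        field_simp
        refine mul_left_cancel₀ (hc0 j) ?_
        linear_combination hmul)
    have hk : k = k' := by
      rw [f] at f'
      exact Subtype.ext (Units.ext (mul_right_cancel₀ (Units.ne_zero _) f'))
    subst hk
    exact ⟨rfl, hinj _ _ (e.trans e'.symm)⟩

theorem exists_mem_splitBlock (ha : IsLineReps L a)
    (hrange : ∀ y : Eˣ, y ^ n = 1 → y ∈ ψ.range) (hnd : ∀ y : Eˣ, (y ^ n) ^ d = 1)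
    (hcL : ∀ k, c k ∈ L) (hc : ∀ k : rootsOfUnity d E, c k ^ n * ((k : Eˣ) : E) = 1)
    (j : rootsOfUnity d E) (x : ZMod n) :
    ∃ i, ∃ z ∈ splitBlock ψ c L a j i, (ψ (Multiplicative.ofAdd (x - z)) : E) ∈ L := by
  by_cases hx : (ψ (Multiplicative.ofAdd x) : E) ∈ L
  · exact ⟨none, 0, by simp [splitBlock], by simpa using hx⟩
  have hn : n ≠ 0 := NeZero.ne n
  have hc0 : ∀ k, c k ≠ 0 := fun k h0 => by
    have := hc k
    rw [h0, zero_pow hn, zero_mul] at this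
    exact zero_ne_one this
  obtain ⟨p, b, hb, t, ht, hy⟩ := ha.exists_eq _ hx
  let y : Eˣ := Units.mk0 (a p + t) (ha.add_ne_zero ht)
  let k : rootsOfUnity d E := ⟨y ^ n, hnd y⟩ * j⁻¹
  have hk : (a p + t) ^ n = ((k : Eˣ) : E) * ((j : Eˣ) : E) := by
    simp [k, y]
  obtain ⟨z, hz⟩ := hrange (Units.mk0 (c k) (hc0 k) * Units.mk0 (c j) (hc0 j) * y) (by
    ext
    simp only [Units.val_pow_eq_pow_val, Units.val_mul, Units.val_mk0, Units.val_one, y, mul_pow,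
      hk]
    linear_combination (c j ^ n * ((j : Eˣ) : E)) * hc k + hc j)
  have hzE : (ψ z : E) = c k * c j * (a p + t) := by rw [hz]; rfl
  refine ⟨some (p, k), z.toAdd, ?_, ?_⟩
  · simp only [splitBlock, Finset.mem_filter, Finset.mem_univ, true_and]
    exact ⟨t, ht, hzE, hk⟩
  · have : (ψ (Multiplicative.ofAdd (x - z.toAdd)) : E) = b / (c k * c j) := by
      rw [ofAdd_sub, map_div, Units.val_div_eq_div_val, ofAdd_toAdd, hzE, hy]
      have := hc0 k
      have := hc0 j
      have := ha.add_ne_zero (p := p) ht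
      field_simp
    rw [this]
    exact L.div_mem hb (L.mul_mem (hcL _) (hcL _))

end Blocks
theorem exists_isLineReps {E : Type} [Field E] [Finite E] (L : Subfield E) :
    ∃ (P : Type) (a : P → E), Finite P ∧
      Nat.card P * (Nat.card L - 1) = Nat.card E / Nat.card L - 1 ∧ IsLineReps L a := by
  let S : Submodule L E := Submodule.span L {1}
  have hS : ∀ x : E, x ∈ S ↔ x ∈ L := fun x => by
    rw [Submodule.mem_span_singleton]
    refine ⟨?_, fun hx => ⟨⟨x, hx⟩, by simp [Subfield.smul_def]⟩⟩
    rintro ⟨c, rfl⟩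
    simp [Subfield.smul_def]
  have hcardS : Nat.card S = Nat.card L := Nat.card_congr (Equiv.subtypeEquivRight hS)
  have hcard : Nat.card (E ⧸ S) = Nat.card E / Nat.card L := by
    rw [Submodule.card_eq_card_quotient_mul_card S, hcardS, Nat.mul_div_cancel_left _ Nat.card_pos]
  choose f hf using Submodule.Quotient.mk_surjective S
  have : Finite (E ⧸ S) := Finite.of_surjective _ (Submodule.Quotient.mk_surjective S)
  refine ⟨Projectivization L (E ⧸ S), fun p => f p.rep,
    Projectivization.finite_of_finite _ _, ?_, ?_, ?_, ?_⟩
  · rw [← Projectivization.card, hcard]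
  · intro p hp
    rw [← hS, ← Submodule.Quotient.mk_eq_zero, hf] at hp
    exact p.rep_nonzero hp
  · intro y hy
    have hy0 : (Submodule.Quotient.mk y : E ⧸ S) ≠ 0 := by
      rwa [Ne, Submodule.Quotient.mk_eq_zero, hS]
    obtain ⟨b, hb⟩ := Projectivization.exists_smul_eq_mk_rep L _ hy0
    refine ⟨Projectivization.mk L _ hy0, (b⁻¹ : Lˣ).val, Subtype.mem _,
      b.val * y - f (Projectivization.mk L _ hy0).rep, ?_, ?_⟩
    · rw [← hS, ← Submodule.Quotient.mk_eq_zero, Submodule.Quotient.mk_sub, hf, ← hb]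
      exact sub_self _
    · have : (b.val : E) ≠ 0 := by simp
      simp [this]
  · intro p p' b hb t ht h
    have h1 := congrArg (Submodule.Quotient.mk (p := S)) h
    rw [Submodule.Quotient.mk_add, (Submodule.Quotient.mk_eq_zero S).2 ((hS t).2 ht), add_zero,
      hf, show b * f p.rep = (⟨b, hb⟩ : L) • f p.rep from rfl, Submodule.Quotient.mk_smul, hf] at h1
    rw [← p.mk_rep, ← p'.mk_rep, eq_comm, Projectivization.mk_eq_mk_iff']
    exact ⟨_, h1.symm⟩

theorem inSub_iff_mul_eq_zero {n s d e : ℕ} [NeZero n] (hn : n = s * e) (hsd : s.Coprime d)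
    (x : ZMod n) : inSub n s x ↔ ((d * e : ℕ) : ZMod n) * x = 0 := by
  constructor
  · rintro ⟨y, rfl⟩
    rw [← mul_assoc, ← Nat.cast_mul, show d * e * s = n * d by rw [hn]; ring]
    simp
  · intro h
    have he : 0 < e := Nat.pos_of_ne_zero fun h0 => NeZero.ne n (by rw [hn, h0, mul_zero])
    rw [← ZMod.natCast_zmod_val x, ← Nat.cast_mul, ZMod.natCast_eq_zero_iff] at h
    have h1 : s ∣ d * x.val := by
      refine Nat.dvd_of_mul_dvd_mul_right he ?_
      rw [← hn]
      convert h using 1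
      ring
    obtain ⟨v, hv⟩ := hsd.dvd_of_dvd_mul_left h1
    exact ⟨v, by rw [← Nat.cast_mul, ← hv, ZMod.natCast_zmod_val]⟩

theorem exists_zmod_hom_range_eq {G : Type*} [Group G] [IsCyclic G] (K : Subgroup G) (n : ℕ)
    (h : Nat.card K = n) :
    ∃ ψ : Multiplicative (ZMod n) →* G, Function.Injective ψ ∧ ψ.range = K := by
  subst h
  let e := zmodCyclicMulEquiv (G := K) inferInstance
  refine ⟨K.subtype.comp e.toMonoidHom, K.subtype_injective.comp e.injective, ?_⟩
  ext y
  refine ⟨?_, fun hy => ?_⟩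
  · rintro ⟨z, rfl⟩
    exact (e z).2
  · obtain ⟨z, hz⟩ := e.surjective ⟨y, hy⟩
    exact ⟨z, congrArg Subtype.val hz⟩

theorem exists_subfield_card (q m : ℕ) (hq : IsPrimePow q) (hm : m ≠ 0) :
    ∃ (E : Type) (_ : Field E) (_ : Finite E) (L : Subfield E),
      Nat.card E = q ^ m ∧ Nat.card L = q := by
  obtain ⟨p, r, hp, hr, rfl⟩ := hq
  have : Fact p.Prime := ⟨hp.nat_prime⟩
  have : NeZero m := ⟨hm⟩
  refine ⟨FiniteField.Extension (GaloisField p r) p m, inferInstance, inferInstance,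
    (algebraMap (GaloisField p r) _).fieldRange, ?_, ?_⟩
  · rw [FiniteField.natCard_extension, GaloisField.card p r hr.ne']
  · rw [← GaloisField.card p r hr.ne']
    exact Nat.card_congr (RingHom.rangeRestrictFieldEquiv _).symm.toEquiv

theorem mem_subfield_iff_pow_eq_one {E : Type*} [Field E] [Finite E] (L : Subfield E) (x : Eˣ) :
    (x : E) ∈ L ↔ x ^ (Nat.card L - 1) = 1 := by
  have hcard : Nat.card Lˣ = Nat.card L - 1 := Nat.card_units L
  let f : Lˣ →* Eˣ := Units.map L.subtype.toMonoidHom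
  have hf : Function.Injective f := Units.map_injective L.subtype_injective
  have hker : Nat.card (powMonoidHom (α := Eˣ) (Nat.card L - 1)).ker ≤ Nat.card L - 1 := by
    rw [IsCyclic.card_powMonoidHom_ker]
    exact Nat.gcd_le_right _ (by rw [← hcard]; exact Nat.card_pos)
  have hle : f.range ≤ (powMonoidHom (α := Eˣ) (Nat.card L - 1)).ker := by
    rintro _ ⟨y, rfl⟩
    rw [MonoidHom.mem_ker, powMonoidHom_apply, ← map_pow, ← hcard, pow_card_eq_one', map_one]
  have heq : f.range = (powMonoidHom (α := Eˣ) (Nat.card L - 1)).ker := by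
    refine Subgroup.eq_of_le_of_card_ge hle ?_
    rw [Nat.card_congr (MonoidHom.ofInjective hf).symm.toEquiv, hcard]
    exact hker
  constructor
  · intro hx
    have : x ∈ f.range := ⟨Units.mk0 ⟨x, hx⟩ (by simp [← Subtype.coe_ne_coe]), by ext; rfl⟩
    rwa [heq] at this
  · intro hx
    have : x ∈ f.range := by rw [heq]; exact hx
    obtain ⟨y, rfl⟩ := this
    exact y.val.2

theorem exists_pow_eq_of_coprime {G : Type*} [CommGroup G] [IsCyclic G] [Finite G] {s d e : ℕ}
    (hcard : Nat.card G = s * e * d) (hsd : s.Coprime d) (k : G) (hk : k ^ d = 1) :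
    ∃ c : G, c ^ (d * e) = 1 ∧ c ^ (s * e) = k := by
  have hse : 0 < s * e := Nat.pos_of_ne_zero fun h0 =>
    Nat.card_pos.ne' (by rw [hcard, h0, zero_mul])
  have hker : Nat.card (powMonoidHom (α := G) d).ker = d := by
    rw [IsCyclic.card_powMonoidHom_ker, hcard, Nat.gcd_mul_left_left]
  have heq : (powMonoidHom (α := G) (s * e)).range = (powMonoidHom (α := G) d).ker := by
    refine Subgroup.eq_of_le_of_card_ge ?_ ?_
    · rintro _ ⟨w, rfl⟩
      rw [MonoidHom.mem_ker, powMonoidHom_apply, powMonoidHom_apply, ← pow_mul, ← hcard,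
        pow_card_eq_one']
    · rw [hker, IsCyclic.card_powMonoidHom_range, hcard, Nat.gcd_mul_right_left,
        Nat.mul_div_cancel_left _ hse]
  obtain ⟨k', hk'⟩ := (powCoprime (n := s) (by rw [hker]; exact hsd.symm)).surjective
    (⟨k, hk⟩ : (powMonoidHom (α := G) d).ker)
  obtain ⟨w, hw⟩ : (k' : G) ∈ (powMonoidHom (α := G) (s * e)).range := by
    rw [heq]; exact k'.2
  rw [powMonoidHom_apply] at hw
  refine ⟨w ^ s, ?_, ?_⟩
  · rw [← pow_mul, show s * (d * e) = s * e * d by ring, ← hcard, pow_card_eq_one']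
  · rw [← pow_mul, mul_comm, pow_mul, hw]
    exact congrArg Subtype.val hk'

theorem coprime_geom_quotient {q d m : ℕ} (hq : 2 ≤ q) (hdq : d ∣ q - 1) (hgcd : Nat.gcd m d = 1) :
    ((q ^ m - 1) / (q - 1)).Coprime d := by
  have h1 : q ≡ 1 [MOD d] := ((Nat.modEq_iff_dvd' (by lia)).2 hdq).symm
  rw [← Nat.geomSum_eq hq]
  have h2 : ∑ i ∈ Finset.range m, q ^ i ≡ m [MOD d] := by
    simpa using Nat.ModEq.sum (s := Finset.range m) fun i _ => h1.pow i
  rw [Nat.Coprime, h2.gcd_eq, hgcd]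

theorem stmt3 (q d m : ℕ) (hq : IsPrimePow q) (hd : 0 < d) (hm : 2 ≤ m)
    (hdq : d ∣ q - 1) (hgcd : Nat.gcd m d = 1) :
    ∃ K : Fin d → Set ℕ,
    ∃ A : Fin d → Fin (d * (q ^ (m - 1) - 1) / (q - 1) + 1) → Finset (ZMod ((q ^ m - 1) / d)),
      IsBNCDP ((q ^ m - 1) / d) d (d * (q ^ (m - 1) - 1) / (q - 1) + 1) 1 K A ∧
      ∀ j, IsCSR ((q ^ m - 1) / d) ((q ^ m - 1) / (q - 1)) (blockElems (A j)) := by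
  have hq2 : 2 ≤ q := hq.two_le
  obtain ⟨E, _, _, L, hE, hL⟩ := exists_subfield_card q m hq (by lia)
  obtain ⟨P, a, _, hP, ha⟩ := exists_isLineReps L
  have hsd := coprime_geom_quotient (m := m) hq2 hdq hgcd
  have hs : (q ^ m - 1) / (q - 1) * (q - 1) = q ^ m - 1 :=
    Nat.div_mul_cancel (by simpa using Nat.sub_dvd_pow_sub_pow q 1 m)
  have hN : 0 < q ^ m - 1 := by
    have := Nat.one_lt_pow (n := m) (by lia) hq2
    lia
  obtain ⟨e, he⟩ := hdq
  have hnd : (q ^ m - 1) / d = (q ^ m - 1) / (q - 1) * e := by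
    refine Nat.div_eq_of_eq_mul_left hd ?_
    rw [mul_assoc, mul_comm e d, ← he, hs]
  have hu : d * (q ^ (m - 1) - 1) / (q - 1) = Nat.card P * d := by
    have hPc : Nat.card P * (q - 1) = q ^ (m - 1) - 1 := by
      obtain ⟨m, rfl⟩ : ∃ r, m = r + 1 := ⟨m - 1, by lia⟩
      rw [hL, hE, pow_succ, Nat.mul_div_cancel _ (by lia)] at hP
      simpa using hP
    rw [← hPc, ← mul_assoc, Nat.mul_div_cancel _ (by lia), mul_comm]
  generalize hs' : (q ^ m - 1) / (q - 1) = s at *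
  generalize hn' : (q ^ m - 1) / d = n at *
  generalize d * (q ^ (m - 1) - 1) / (q - 1) = u at *
  have hcardU : Nat.card Eˣ = s * e * d := by
    rw [Nat.card_units, hE, ← hs, he]; ring
  have : NeZero n := ⟨fun h0 => by
    rw [← hs, he, mul_comm d e, ← mul_assoc, ← hnd, h0, zero_mul] at hN
    exact lt_irrefl _ hN⟩
  have : NeZero d := ⟨hd.ne'⟩
  obtain ⟨ψ, hψ, hψr⟩ := exists_zmod_hom_range_eq (powMonoidHom (α := Eˣ) n).ker n (by
    rw [IsCyclic.card_powMonoidHom_ker, hcardU, ← hnd, Nat.gcd_mul_right_left])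
  have hexc : ∀ k : rootsOfUnity d E, ∃ c ∈ L, c ^ n * ((k : Eˣ) : E) = 1 := fun k => by
    obtain ⟨c, hc, hck⟩ := exists_pow_eq_of_coprime hcardU hsd (k⁻¹ : rootsOfUnity d E).1
      (k⁻¹).2
    refine ⟨c, (mem_subfield_iff_pow_eq_one L c).2 (by rw [hL, he, hc]), ?_⟩
    rw [hnd, ← Units.val_pow_eq_pow_val, hck, ← Units.val_mul]
    simp
  choose c hcL hc using hexc
  have hc0 : ∀ k, c k ≠ 0 := fun k h0 => by
    have := hc k
    rw [h0, zero_pow (NeZero.ne n), zero_mul] at this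
    exact zero_ne_one this
  have hcardR : Nat.card (rootsOfUnity d E) = d := by
    have : rootsOfUnity d E = (powMonoidHom (α := Eˣ) d).ker := by ext; rfl
    rw [this, IsCyclic.card_powMonoidHom_ker, hcardU, Nat.gcd_mul_left_left]
  have hsub : ∀ x : ZMod n, inSub n s x ↔ (ψ (Multiplicative.ofAdd x) : E) ∈ L := fun x => by
    rw [inSub_iff_mul_eq_zero hnd hsd, ← he, mem_subfield_iff_pow_eq_one, hL, ← map_pow,
      map_eq_one_iff ψ hψ, ← ofAdd_nsmul, nsmul_eq_mul, ofAdd_eq_one]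
  let ej : Fin d ≃ rootsOfUnity d E := (Finite.equivFinOfCardEq hcardR).symm
  let ei : Fin (u + 1) ≃ Option (P × rootsOfUnity d E) :=
    (Finite.equivFinOfCardEq (by
      rw [Finite.card_option, Nat.card_prod, hcardR, hu])).symm
  refine ⟨fun _ => Set.univ, fun j i => splitBlock ψ c L a (ej j) (ei i),
    ⟨fun j => ⟨fun _ => trivial, fun x _ => ?_⟩, fun j j' hjj x => ?_⟩, fun j x => ?_⟩
  · rw [deltaList]
    refine count_sum_map_le_one _ _ _ ?_
    rintro i i' ⟨z₁, z₂⟩ hz ⟨w₁, w₂⟩ hw hzx hwx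
    simp only [Finset.mem_filter, Finset.mem_product] at hz hw
    obtain ⟨hi, h₁, h₂⟩ := splitBlock_eq_of_sub_eq ha hψ hcL hc0 hz.1.1 hz.1.2 hw.1.1 hw.1.2
      (fun _ => hz.2) (fun _ => hw.2) (hzx.trans hwx.symm)
    exact ⟨ei.injective hi, Prod.ext h₁ h₂⟩
  · rw [deltaE]
    refine count_sum_map_le_one _ _ _ ?_
    rintro i i' ⟨z₁, z₂⟩ hz ⟨w₁, w₂⟩ hw hzx hwx
    simp only [Finset.mem_product] at hz hw
    have hne : ej j ≠ ej j' := ej.injective.ne hjj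
    obtain ⟨hi, h₂, h₁⟩ := splitBlock_eq_of_sub_eq ha hψ hcL hc0 hz.2 hz.1 hw.2 hw.1
      (fun h => absurd h.symm hne) (fun h => absurd h.symm hne) (hzx.trans hwx.symm)
    exact ⟨ei.injective hi, Prod.ext h₁ h₂⟩
  · refine card_filter_sum_eq_one _ _ ?_ ?_
    · obtain ⟨i, z, hz, hL⟩ := exists_mem_splitBlock ha
        (fun y hy => by rw [hψr]; exact hy)
        (fun y => by rw [← pow_mul, hnd, ← hcardU, pow_card_eq_one']) hcL hc (ej j) x
      exact ⟨ei.symm i, z, by simpa using hz, (hsub _).2 hL⟩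
    · intro i i' z hz w hw hzx hwx
      rw [hsub] at hzx hwx
      obtain ⟨hi, h⟩ := splitBlock_eq_of_div_mem ha hψ hcL hc0 hz hw (by
        rw [show z - w = (x - w) - (x - z) by ring, ofAdd_sub, map_div, Units.val_div_eq_div_val]
        exact L.div_mem hwx hzx)
      exact ⟨ei.injective hi, h⟩
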